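/- arXiv:1002.2209 — 2 statements merged into one kernel-verified Lean document; each statement's English description precedes it below -/
import Mathlib

section
/- Let p be a prime, ω = e^{2πi/p}, and let C > 0 be a constant for which the following U^3 inverse statement holds: for every 0 < δ ≤ 1 and every φ : 𝔽_p^n → ℂ with ‖φ‖_∞ ≤ 1 and ‖φ‖_{U^3} ≥ δ, there exists a quadratic form q : 𝔽_p^n → 𝔽_p such that |𝔼_x φ(x)ω^{q(x)}| ≥ exp(−Cδ^{−C}). Then for every f : 𝔽_p^n → ℂ with ‖f‖_2 ≤ 1 and every δ > 0 and η > 0, setting M = exp(C(ηδ)^{−C}), the function f admits a decomposition f(x) = Σ_i λ_i ω^{q_i(x)} + g(x) + h(x), where the q_i are quadratic forms on 𝔽_p^n, the λ_i are complex scalars, and η^{−1}‖g‖_1 + δ^{−1}‖h‖_{U^3} + M^{−1}Σ_i|λ_i| ≤ 1. -/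
open scoped BigOperators

instance instNeZeroOfFactPrime (p : ℕ) [hp : Fact p.Prime] : NeZero p :=
  ⟨hp.out.ne_zero⟩

/-- The vector space `𝔽_p^n`. -/
abbrev Vec (p n : ℕ) := Fin n → ZMod p

/-- `ω^t` where `ω = e^{2πi/p}`. -/
noncomputable def omg (p : ℕ) (t : ZMod p) : ℂ :=
  Complex.exp (2 * Real.pi * Complex.I * (t.val : ℂ) / p)

/-- Average of a complex-valued function over a finite type. -/
noncomputable def avgC {α : Type*} [Fintype α] (f : α → ℂ) : ℂ :=
  (∑ x, f x) / (Fintype.card α : ℂ)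

/-- Average of a real-valued function over a finite type. -/
noncomputable def avgR {α : Type*} [Fintype α] (f : α → ℝ) : ℝ :=
  (∑ x, f x) / (Fintype.card α : ℝ)

/-- The Gowers `U²` norm. -/
noncomputable def U2 {p n : ℕ} [NeZero p] (f : Vec p n → ℂ) : ℝ :=
  ‖avgC (fun t : Vec p n × Vec p n × Vec p n =>
    f t.1 * star (f (t.1 + t.2.1)) * star (f (t.1 + t.2.2)) *
      f (t.1 + t.2.1 + t.2.2))‖ ^ ((1 : ℝ) / 4)

/-- The Gowers `U³` norm. -/
noncomputable def U3 {p n : ℕ} [NeZero p] (f : Vec p n → ℂ) : ℝ :=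
  ‖avgC (fun t : Vec p n × Vec p n × Vec p n × Vec p n =>
    f t.1 * star (f (t.1 + t.2.1)) * star (f (t.1 + t.2.2.1)) *
      f (t.1 + t.2.1 + t.2.2.1) * star (f (t.1 + t.2.2.2)) *
      f (t.1 + t.2.1 + t.2.2.2) * f (t.1 + t.2.2.1 + t.2.2.2) *
      star (f (t.1 + t.2.1 + t.2.2.1 + t.2.2.2)))‖ ^ ((1 : ℝ) / 8)

/-- `L¹` norm (with respect to the uniform probability measure). -/
noncomputable def L1 {p n : ℕ} [NeZero p] (f : Vec p n → ℂ) : ℝ :=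
  avgR (fun x => ‖f x‖)

/-- `L²` norm (with respect to the uniform probability measure). -/
noncomputable def L2 {p n : ℕ} [NeZero p] (f : Vec p n → ℂ) : ℝ :=
  Real.sqrt (avgR (fun x => ‖f x‖ ^ 2))

/-- `L∞` norm. -/
noncomputable def Linf {p n : ℕ} [NeZero p] (f : Vec p n → ℂ) : ℝ :=
  ⨆ x, ‖f x‖

/-- Normalized inner product `⟨f,g⟩ = 𝔼_x f(x) conj (g x)`. -/
noncomputable def inprod {p n : ℕ} [NeZero p] (f g : Vec p n → ℂ) : ℂ :=
  avgC (fun x => f x * star (g x))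

/-- The dual of the `U²` norm. -/
noncomputable def U2dual {p n : ℕ} [NeZero p] (g : Vec p n → ℂ) : ℝ :=
  sSup {r : ℝ | ∃ f : Vec p n → ℂ, U2 f ≤ 1 ∧ r = ‖inprod f g‖}

/-- The elements of a submodule of `𝔽_p^n` as a `Finset`. -/
noncomputable def subFinset {p n : ℕ} [NeZero p] (V : Submodule (ZMod p) (Vec p n)) :
    Finset (Vec p n) :=
  letI := Classical.decPred (fun v => v ∈ (V : Set (Vec p n)))
  Finset.univ.filter (fun v => v ∈ (V : Set (Vec p n)))

/-- Convolution `f * μ_V`, i.e. the average of `f` over the coset `x + V`. -/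
noncomputable def convMu {p n : ℕ} [NeZero p] (f : Vec p n → ℂ)
    (V : Submodule (ZMod p) (Vec p n)) (x : Vec p n) : ℂ :=
  (∑ v ∈ subFinset V, f (x + v)) / ((subFinset V).card : ℂ)

/-- The associated symmetric form `β(u,v) = q(u+v) - q(u) - q(v)`. -/
def qbeta {p n : ℕ} (q : Vec p n → ZMod p) (u v : Vec p n) : ZMod p :=
  q (u + v) - q u - q v

/-- `q` is a quadratic form on the subspace `V`: `q 0 = 0` and the associated
form `β` is (bi-)additive on `V`. -/
def IsQuadFormOn {p n : ℕ} (V : Submodule (ZMod p) (Vec p n))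
    (q : Vec p n → ZMod p) : Prop :=
  q 0 = 0 ∧ ∀ u ∈ V, ∀ v ∈ V, ∀ w ∈ V, qbeta q u (v + w) = qbeta q u v + qbeta q u w

/-- The radical `{v ∈ V : β(u,v) = 0 for all u ∈ V}` of the form associated to `q`
(as the span of that set, which equals the set itself when `q` is quadratic). -/
noncomputable def qRadical {p n : ℕ} (V : Submodule (ZMod p) (Vec p n))
    (q : Vec p n → ZMod p) : Submodule (ZMod p) (Vec p n) :=
  Submodule.span (ZMod p) {v | v ∈ V ∧ ∀ u ∈ V, qbeta q u v = 0}

/-- The rank of the quadratic form `q` on `V`: the codimension in `V` of the radical. -/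
noncomputable def qRank {p n : ℕ} (V : Submodule (ZMod p) (Vec p n))
    (q : Vec p n → ZMod p) : ℕ :=
  Module.finrank (ZMod p) V - Module.finrank (ZMod p) (qRadical V q)

/-- `Q` is a quadratic average with base `(V, q)`:
`Q(x) = 𝔼_{y ∈ x+V} ω^{q(x-y) + φ_y(x-y)}` with each `φ_y` linear on `V`.
(Parametrizing `y = x - v` with `v ∈ V`, this reads `Q(x) = 𝔼_{v ∈ V} ω^{q(v) + φ_{x-v}(v)}`.) -/
def IsQuadAvgWith {p n : ℕ} [NeZero p] (V : Submodule (ZMod p) (Vec p n))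
    (q : Vec p n → ZMod p) (Q : Vec p n → ℂ) : Prop :=
  IsQuadFormOn V q ∧
  ∃ φ : Vec p n → Vec p n → ZMod p,
    (∀ y, ∀ u ∈ V, ∀ v ∈ V, φ y (u + v) = φ y u + φ y v) ∧
    ∀ x, Q x = (∑ v ∈ subFinset V, omg p (q v + φ (x - v) v)) / ((subFinset V).card : ℂ)

/-- The radical of a bilinear form `β` restricted to the subspace `W`. -/
noncomputable def bRadical {p n : ℕ} (W : Submodule (ZMod p) (Vec p n))
    (β : Vec p n →ₗ[ZMod p] Vec p n →ₗ[ZMod p] ZMod p) :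
    Submodule (ZMod p) (Vec p n) :=
  Submodule.span (ZMod p) {y | y ∈ W ∧ ∀ x ∈ W, β x y = 0}

/-- The rank of the bilinear form `β` restricted to the subspace `W`. -/
noncomputable def bRankOn {p n : ℕ} (W : Submodule (ZMod p) (Vec p n))
    (β : Vec p n →ₗ[ZMod p] Vec p n →ₗ[ZMod p] ZMod p) : ℕ :=
  Module.finrank (ZMod p) W - Module.finrank (ZMod p) (bRadical W β)

/-- `q : 𝔽_p^n → 𝔽_p` is a polynomial map of degree at most 2. -/
def IsPolyQuad {p n : ℕ} (q : Vec p n → ZMod p) : Prop :=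
  ∃ (M : Matrix (Fin n) (Fin n) (ZMod p)) (b : Fin n → ZMod p) (e : ZMod p),
    ∀ x, q x = (∑ u, ∑ v, M u v * x u * x v) + (∑ u, b u * x u) + e

section Gowers

variable {G : Type*} [AddCommGroup G] [Fintype G]

/-- The Gowers inner product of eight functions. -/
noncomputable def gowersInner (f₀ f₁ f₂ f₃ f₄ f₅ f₆ f₇ : G → ℂ) : ℂ :=
  avgC (fun t : G × G × G × G =>
    f₀ t.1 * star (f₁ (t.1 + t.2.1)) * star (f₂ (t.1 + t.2.2.1)) *
      f₃ (t.1 + t.2.1 + t.2.2.1) * star (f₄ (t.1 + t.2.2.2)) *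
      f₅ (t.1 + t.2.1 + t.2.2.2) * f₆ (t.1 + t.2.2.1 + t.2.2.2) *
      star (f₇ (t.1 + t.2.1 + t.2.2.1 + t.2.2.2)))

lemma norm_sum_mul_star_sq_le {W : Type*} [Fintype W] (u v : W → ℂ) :
    ‖∑ w, u w * star (v w)‖ ^ 2 ≤
      ‖∑ w, u w * star (u w)‖ * ‖∑ w, v w * star (v w)‖ := by
  have key : ∀ u : W → ℂ, ‖∑ w, u w * star (u w)‖ = ∑ w, ‖u w‖ ^ 2 := by
    intro u
    have : ∑ w, u w * star (u w) = ((∑ w, ‖u w‖ ^ 2 : ℝ) : ℂ) := by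
      push_cast
      exact Finset.sum_congr rfl fun w _ => Complex.mul_conj' (u w)
    rw [this, Complex.norm_real, Real.norm_of_nonneg (by positivity)]
  rw [key, key]
  calc ‖∑ w, u w * star (v w)‖ ^ 2 ≤ (∑ w, ‖u w‖ * ‖v w‖) ^ 2 := by
        gcongr
        exact (norm_sum_le _ _).trans (by simp)
    _ ≤ _ := Finset.sum_mul_sq_le_sq_mul_sq _ _ _

lemma gowersInner_eq (f₀ f₁ f₂ f₃ f₄ f₅ f₆ f₇ : G → ℂ) :
    gowersInner f₀ f₁ f₂ f₃ f₄ f₅ f₆ f₇ =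
      (∑ w : G × G,
        (∑ x, f₀ x * star (f₁ (x + w.1)) * star (f₂ (x + w.2)) * f₃ (x + w.1 + w.2)) *
        star (∑ x, f₄ x * star (f₅ (x + w.1)) * star (f₆ (x + w.2)) * f₇ (x + w.1 + w.2))) /
      (Fintype.card (G × G × G × G) : ℂ) := by
  unfold gowersInner avgC
  congr 1
  simp only [Fintype.sum_prod_type]
  rw [Finset.sum_comm]
  refine Finset.sum_congr rfl fun a _ => ?_
  rw [Finset.sum_comm]
  refine Finset.sum_congr rfl fun b _ => ?_
  rw [Finset.sum_mul]
  refine Finset.sum_congr rfl fun x _ => ?_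
  rw [← Equiv.sum_comp (Equiv.addLeft x) (fun y =>
    f₄ y * star (f₅ (y + a)) * star (f₆ (y + b)) * f₇ (y + a + b)), star_sum, Finset.mul_sum]
  refine Finset.sum_congr rfl fun c _ => ?_
  simp only [Equiv.coe_addLeft, star_mul', star_star]
  rw [add_right_comm x c a, add_right_comm x c b, add_right_comm (x + a) c b]
  ring

lemma norm_gowersInner_sq_le (f₀ f₁ f₂ f₃ f₄ f₅ f₆ f₇ : G → ℂ) :
    ‖gowersInner f₀ f₁ f₂ f₃ f₄ f₅ f₆ f₇‖ ^ 2 ≤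
      ‖gowersInner f₀ f₁ f₂ f₃ f₀ f₁ f₂ f₃‖ * ‖gowersInner f₄ f₅ f₆ f₇ f₄ f₅ f₆ f₇‖ := by
  simp only [gowersInner_eq, norm_div]
  rw [div_pow, div_mul_div_comm, ← sq]
  gcongr
  exact norm_sum_mul_star_sq_le _ _

lemma gowersInner_rotate (f₀ f₁ f₂ f₃ f₄ f₅ f₆ f₇ : G → ℂ) :
    gowersInner f₀ f₁ f₂ f₃ f₄ f₅ f₆ f₇ = gowersInner f₀ f₄ f₁ f₅ f₂ f₆ f₃ f₇ := by
  unfold gowersInner avgC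
  congr 1
  let e : G × G × G × G ≃ G × G × G × G :=
    ⟨fun t => (t.1, t.2.2.1, t.2.2.2, t.2.1), fun t => (t.1, t.2.2.2, t.2.1, t.2.2.1),
      fun _ => rfl, fun _ => rfl⟩
  rw [← Equiv.sum_comp e]
  refine Finset.sum_congr rfl fun t _ => ?_
  obtain ⟨x, a, b, c⟩ := t
  simp only [e, Equiv.coe_fn_mk]
  rw [add_right_comm x b a, add_right_comm x c a, add_right_comm (x + b) c a,
    add_right_comm x b a]
  ring

lemma gowersInner_self_add_left (f g k : G → ℂ) :
    gowersInner (f + g) k k k k k k k =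
      gowersInner f k k k k k k k + gowersInner g k k k k k k k := by
  simp only [gowersInner, avgC, Pi.add_apply, add_mul, Finset.sum_add_distrib, add_div]

/-- The Gowers–Cauchy–Schwarz inequality when all but the first function agree. -/
lemma norm_gowersInner_pow_le (f k : G → ℂ) :
    ‖gowersInner f k k k k k k k‖ ^ 8 ≤
      ‖gowersInner f f f f f f f f‖ * ‖gowersInner k k k k k k k k‖ ^ 7 := by
  have h1 := norm_gowersInner_sq_le f k k k k k k k
  have h2 := norm_gowersInner_sq_le f f k k k k k k
  have h3 := norm_gowersInner_sq_le f f f f k k k k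
  rw [gowersInner_rotate f k k k f k k k] at h1
  rw [gowersInner_rotate f f k k f f k k] at h2
  calc ‖gowersInner f k k k k k k k‖ ^ 8
      = ((‖gowersInner f k k k k k k k‖ ^ 2) ^ 2) ^ 2 := by ring
    _ ≤ ((‖gowersInner f f k k k k k k‖ * ‖gowersInner k k k k k k k k‖) ^ 2) ^ 2 := by
        gcongr
    _ = (‖gowersInner f f k k k k k k‖ ^ 2) ^ 2 * ‖gowersInner k k k k k k k k‖ ^ 4 := by ring
    _ ≤ (‖gowersInner f f f f k k k k‖ * ‖gowersInner k k k k k k k k‖) ^ 2 *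
          ‖gowersInner k k k k k k k k‖ ^ 4 := by gcongr
    _ = ‖gowersInner f f f f k k k k‖ ^ 2 * ‖gowersInner k k k k k k k k‖ ^ 6 := by ring
    _ ≤ (‖gowersInner f f f f f f f f‖ * ‖gowersInner k k k k k k k k‖) *
          ‖gowersInner k k k k k k k k‖ ^ 6 := by gcongr
    _ = _ := by ring

end Gowers

lemma norm_avgC_le {α : Type*} [Fintype α] (f : α → ℂ) : ‖avgC f‖ ≤ avgR fun x => ‖f x‖ := by
  unfold avgC avgR
  rw [norm_div, Complex.norm_natCast]
  gcongr
  exact norm_sum_le _ _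

lemma avgC_const_mul {α : Type*} [Fintype α] (c : ℂ) (f : α → ℂ) :
    avgC (fun x => c * f x) = c * avgC f := by
  simp only [avgC, ← Finset.mul_sum, mul_div_assoc]

lemma avgC_star {α : Type*} [Fintype α] (f : α → ℂ) :
    avgC (fun x => star (f x)) = star (avgC f) := by
  simp [avgC]

section Norms

variable {p n : ℕ} [NeZero p]

lemma U3_nonneg (f : Vec p n → ℂ) : 0 ≤ U3 f := Real.rpow_nonneg (norm_nonneg _) _

lemma U3_pow_eight (f : Vec p n → ℂ) : U3 f ^ 8 = ‖gowersInner f f f f f f f f‖ := by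
  unfold U3
  rw [← Real.rpow_natCast, ← Real.rpow_mul (norm_nonneg _)]
  norm_num
  rfl

lemma U3_add_le (f g : Vec p n → ℂ) : U3 (f + g) ≤ U3 f + U3 g := by
  have key (f k : Vec p n → ℂ) : ‖gowersInner f k k k k k k k‖ ≤ U3 f * U3 k ^ 7 := by
    refine le_of_pow_le_pow_left₀ (n := 8) (by norm_num)
      (mul_nonneg (U3_nonneg _) (pow_nonneg (U3_nonneg _) _)) ?_
    rw [mul_pow, ← pow_mul, mul_comm 7 8, pow_mul, U3_pow_eight, U3_pow_eight]
    exact norm_gowersInner_pow_le f k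
  rcases (U3_nonneg (f + g)).eq_or_lt with h0 | h0
  · rw [← h0]
    exact add_nonneg (U3_nonneg _) (U3_nonneg _)
  · refine le_of_mul_le_mul_right ?_ (pow_pos h0 7)
    calc U3 (f + g) * U3 (f + g) ^ 7 = U3 (f + g) ^ 8 := by ring
      _ ≤ _ := by
        rw [U3_pow_eight, gowersInner_self_add_left, add_mul]
        exact (norm_add_le _ _).trans (add_le_add (key _ _) (key _ _))

lemma U3_smul (c : ℂ) (f : Vec p n → ℂ) : U3 (c • f) = ‖c‖ * U3 f := by
  refine (pow_left_inj₀ (U3_nonneg _) (mul_nonneg (norm_nonneg _) (U3_nonneg _))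
    (n := 8) (by norm_num)).1 ?_
  rw [mul_pow, U3_pow_eight, U3_pow_eight]
  have : gowersInner (c • f) (c • f) (c • f) (c • f) (c • f) (c • f) (c • f) (c • f) =
      (c ^ 4 * star c ^ 4) * gowersInner f f f f f f f f := by
    unfold gowersInner
    rw [← avgC_const_mul]
    congr 1
    ext t
    simp only [Pi.smul_apply, smul_eq_mul, star_mul']
    ring
  rw [this]
  simp only [norm_mul, norm_pow, norm_star]
  ring

lemma U3_star (f : Vec p n → ℂ) : U3 (star f) = U3 f := by
  refine (pow_left_inj₀ (U3_nonneg _) (U3_nonneg _) (n := 8) (by norm_num)).1 ?_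
  rw [U3_pow_eight, U3_pow_eight, ← norm_star (gowersInner f f f f f f f f)]
  unfold gowersInner
  rw [← avgC_star]
  simp only [star_mul', Pi.star_apply]

lemma continuous_U3 : Continuous (U3 : (Vec p n → ℂ) → ℝ) := by
  unfold U3 avgC
  refine Continuous.rpow_const ?_ fun _ => Or.inr (by norm_num)
  fun_prop

lemma U3_le_one {f : Vec p n → ℂ} (hf : ∀ x, ‖f x‖ ≤ 1) : U3 f ≤ 1 := by
  refine Real.rpow_le_one (norm_nonneg _) ((norm_avgC_le _).trans ?_) (by norm_num)
  unfold avgR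
  rw [div_le_one (by exact_mod_cast Fintype.card_pos)]
  calc _ ≤ ∑ _t : Vec p n × Vec p n × Vec p n × Vec p n, (1 : ℝ) := by
        refine Finset.sum_le_sum fun t _ => ?_
        simp only [norm_mul, norm_star]
        repeat' apply mul_le_one₀
        all_goals first | exact hf _ | positivity
    _ = _ := by simp

lemma L1_add_le (f g : Vec p n → ℂ) : L1 (f + g) ≤ L1 f + L1 g := by
  unfold L1 avgR
  rw [← add_div, ← Finset.sum_add_distrib]
  gcongr
  exact norm_add_le _ _

lemma L1_smul (c : ℂ) (f : Vec p n → ℂ) : L1 (c • f) = ‖c‖ * L1 f := by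
  simp [L1, avgR, ← Finset.mul_sum, mul_div_assoc]

lemma continuous_L1 : Continuous (L1 : (Vec p n → ℂ) → ℝ) := by
  unfold L1 avgR
  fun_prop

lemma L1_zero : L1 (0 : Vec p n → ℂ) = 0 := by simp [L1, avgR]

lemma U3_zero : U3 (0 : Vec p n → ℂ) = 0 := by simpa using U3_smul 0 (0 : Vec p n → ℂ)

lemma L2_sq (f : Vec p n → ℂ) : L2 f ^ 2 = avgR fun x => ‖f x‖ ^ 2 :=
  Real.sq_sqrt (div_nonneg (Finset.sum_nonneg fun _ _ => by positivity) (by positivity))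

lemma norm_avgC_mul_le (f g : Vec p n → ℂ) : ‖avgC (fun x => f x * g x)‖ ≤ L2 f * L2 g := by
  refine (norm_avgC_le _).trans (le_of_sq_le_sq ?_ (mul_nonneg (Real.sqrt_nonneg _)
    (Real.sqrt_nonneg _)))
  rw [mul_pow, L2_sq, L2_sq]
  unfold avgR
  rw [div_pow, div_mul_div_comm, ← sq]
  gcongr
  simp only [norm_mul]
  exact Finset.sum_mul_sq_le_sq_mul_sq _ _ _

lemma L1_le_L2 (f : Vec p n → ℂ) : L1 f ≤ L2 f := by
  refine le_of_sq_le_sq ?_ (Real.sqrt_nonneg _)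
  rw [L2_sq]
  unfold L1 avgR
  have h := Finset.sum_mul_sq_le_sq_mul_sq Finset.univ (fun x => ‖f x‖) (fun _ => (1 : ℝ))
  have hc : (0 : ℝ) < Fintype.card (Vec p n) := by exact_mod_cast Fintype.card_pos
  simp only [mul_one, one_pow, Finset.sum_const, Finset.card_univ, nsmul_eq_mul] at h
  rw [div_pow, div_le_div_iff₀ (by positivity) hc]
  nlinarith

end Norms

/-- Duality: if every functional `L` on `E` such that `L ∘ A` is dominated by `N` has norm less
than `1` at `f`, then `f` has a preimage under `A` in the closed unit ball of `N`. -/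
lemma exists_preimage_seminorm_le_one {X E : Type*} [NormedAddCommGroup X] [NormedSpace ℂ X]
    [CompleteSpace X] [NormedAddCommGroup E] [NormedSpace ℂ E] [CompleteSpace E]
    (A : X →L[ℂ] E) (hA : Function.Surjective A) (N : Seminorm ℂ X) (hN : Continuous N) (f : E)
    (H : ∀ L : E →L[ℂ] ℂ, (∀ x, ‖L (A x)‖ ≤ N x) → ‖L f‖ < 1) :
    ∃ x, A x = f ∧ N x ≤ 1 := by
  by_contra! hcon
  have hball : N.ball 0 1 = {x | N x < 1} := by ext; simp
  have hopen : IsOpen (A '' N.ball 0 1) := by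
    refine A.isOpenMap hA _ ?_
    rw [hball]
    exact isOpen_lt hN continuous_const
  have hconv : Convex ℝ (A '' N.ball 0 1) :=
    (N.convex_ball 0 1).linear_image (A.restrictScalars ℝ).toLinearMap
  have hf : f ∉ A '' N.ball 0 1 := by
    rintro ⟨x, hx, rfl⟩
    rw [hball] at hx
    exact (hcon x rfl).not_gt hx
  obtain ⟨L, hL⟩ := RCLike.geometric_hahn_banach_open_point (𝕜 := ℂ) hconv hopen hf
  set s := RCLike.re (L f) with hs
  have hs0 : 0 < s := by
    have := hL 0 ⟨0, by simp [hball], map_zero A⟩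
    simpa using this
  have hbound : ∀ x, ‖L (A x)‖ ≤ s * N x := by
    intro x
    have hN0 : 0 ≤ N x := apply_nonneg N x
    rw [mul_comm, ← div_le_iff₀ hs0]
    refine le_of_forall_gt_imp_ge_of_dense fun t ht => ?_
    have ht0 : 0 < t := hN0.trans_lt ht
    obtain ⟨c, hc, hc'⟩ := RCLike.exists_norm_eq_mul_self (L (A x))
    have h := hL (A ((c / t : ℂ) • x)) ⟨_, by
      rw [hball, Set.mem_ofPred_eq, map_smul_eq_mul, norm_div, hc, Complex.norm_real,
        Real.norm_of_nonneg ht0.le, one_div, inv_mul_lt_one₀ ht0]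
      exact ht, rfl⟩
    have h2 : L (A ((c / t : ℂ) • x)) = ((‖L (A x)‖ / t : ℝ) : ℂ) := by
      rw [map_smul, map_smul, smul_eq_mul, div_mul_eq_mul_div]
      rw [← hc']
      push_cast
      rfl
    rw [h2] at h
    have h3 : ‖L (A x)‖ / t < s := by simpa using h
    rw [div_lt_iff₀ ht0] at h3
    rw [div_le_iff₀ hs0]
    linarith
  have hlt := H (((s⁻¹ : ℝ) : ℂ) • L) fun x => by
    rw [smul_apply, norm_smul, Complex.norm_real,
      Real.norm_of_nonneg (by positivity), inv_mul_le_iff₀ hs0]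
    exact hbound x
  rw [smul_apply, norm_smul, Complex.norm_real,
    Real.norm_of_nonneg (by positivity), inv_mul_lt_iff₀ hs0, mul_one] at hlt
  exact (RCLike.re_le_norm (L f)).not_gt hlt

/-- A functional controlled by the `L¹` norm and by the `U³` norm is small on the unit ball of
`L²`, as soon as it is small on quadratic phases. -/
lemma norm_dual_lt_one {p n : ℕ} [NeZero p] {C δ η : ℝ} (hδ : 0 < δ) (hη : 0 < η) (hη1 : η < 1)
    (hinv : ∀ δ : ℝ, 0 < δ → δ ≤ 1 → ∀ φ : Vec p n → ℂ, Linf φ ≤ 1 → δ ≤ U3 φ →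
      ∃ q : Vec p n → ZMod p, IsPolyQuad q ∧
        Real.exp (-(C * δ ^ (-C))) ≤ ‖avgC (fun x => φ x * omg p (q x))‖)
    {f : Vec p n → ℂ} (hf : L2 f ≤ 1) (L : (Vec p n → ℂ) →L[ℂ] ℂ)
    (hL1 : ∀ g, ‖L g‖ ≤ η⁻¹ * L1 g) (hU3 : ∀ h, ‖L h‖ ≤ δ⁻¹ * U3 h)
    (hq : ∀ q : Vec p n → ZMod p, IsPolyQuad q →
      ‖L fun x => omg p (q x)‖ ≤ (Real.exp (C * (η * δ) ^ (-C)))⁻¹) :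
    ‖L f‖ < 1 := by
  by_contra! hLf
  have hc : (0 : ℝ) < Fintype.card (Vec p n) := by exact_mod_cast Fintype.card_pos
  have hcC : (Fintype.card (Vec p n) : ℂ) ≠ 0 := by exact_mod_cast hc.ne'
  let φ : Vec p n → ℂ := fun x => Fintype.card (Vec p n) * L (Pi.single x 1)
  have hrep : ∀ F, L F = avgC fun x => F x * φ x := by
    intro F
    have : F = ∑ x, F x • (Pi.single x 1 : Vec p n → ℂ) := by
      ext y
      simp [Finset.sum_apply, Pi.single_apply]
    conv_lhs => rw [this]
    simp only [map_sum, map_smul, smul_eq_mul, avgC, φ]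
    rw [eq_div_iff hcC, Finset.sum_mul]
    exact Finset.sum_congr rfl fun x _ => by ring
  have hφ : ∀ x, ‖φ x‖ ≤ η⁻¹ := by
    intro x
    have h1 : L1 (Pi.single x 1 : Vec p n → ℂ) = (Fintype.card (Vec p n) : ℝ)⁻¹ := by
      unfold L1 avgR
      rw [Finset.sum_eq_single x (fun y _ hy => by simp [hy]) (by simp)]
      simp
    have h := hL1 (Pi.single x 1)
    rw [h1] at h
    simp only [φ, norm_mul, Complex.norm_natCast]
    calc _ ≤ (Fintype.card (Vec p n) : ℝ) * (η⁻¹ * (Fintype.card (Vec p n) : ℝ)⁻¹) := by gcongr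
      _ = _ := by field_simp
  have hφ2 : 1 ≤ L2 φ := by
    have h0 : 0 ≤ L2 φ := Real.sqrt_nonneg _
    rw [hrep] at hLf
    exact hLf.trans ((norm_avgC_mul_le f φ).trans (mul_le_of_le_one_left h0 hf))
  have hφU : δ ≤ U3 φ := by
    have h := hU3 (star φ)
    have h2 : L (star φ) = ((L2 φ ^ 2 : ℝ) : ℂ) := by
      rw [hrep, L2_sq]
      simp only [avgC, avgR, Pi.star_apply]
      push_cast
      congr 1
      exact Finset.sum_congr rfl fun x _ => Complex.conj_mul' (φ x)
    rw [h2, U3_star, Complex.norm_real, Real.norm_of_nonneg (sq_nonneg _)] at h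
    have h3 : 1 ≤ δ⁻¹ * U3 φ := (one_le_pow₀ hφ2).trans h
    rwa [le_inv_mul_iff₀ hδ, mul_one] at h3
  have hψ : ∀ x, ‖((η : ℂ) • φ) x‖ ≤ 1 := by
    intro x
    rw [Pi.smul_apply, norm_smul, Complex.norm_real, Real.norm_of_nonneg hη.le]
    calc η * ‖φ x‖ ≤ η * η⁻¹ := by gcongr; exact hφ x
      _ = 1 := mul_inv_cancel₀ hη.ne'
  have hψU : η * δ ≤ U3 ((η : ℂ) • φ) := by
    rw [U3_smul, Complex.norm_real, Real.norm_of_nonneg hη.le]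
    gcongr
  obtain ⟨q, hqq, hbig⟩ := hinv (η * δ) (by positivity) (hψU.trans (U3_le_one hψ)) _
    (ciSup_le hψ) hψU
  have hsmall := hq q hqq
  have heq : avgC (fun x => ((η : ℂ) • φ) x * omg p (q x)) = η * L fun x => omg p (q x) := by
    rw [hrep, ← avgC_const_mul]
    congr 1
    ext x
    simp only [Pi.smul_apply, smul_eq_mul]
    ring
  rw [heq, norm_mul, Complex.norm_real, Real.norm_of_nonneg hη.le, Real.exp_neg] at hbig
  have hpos : 0 < (Real.exp (C * (η * δ) ^ (-C)))⁻¹ := by positivity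
  nlinarith

/-- The cost of a decomposition into a combination of phases, an `L¹` part and a `U³` part. -/
noncomputable def decompSeminorm {p n : ℕ} [NeZero p] (Q : Type*) [Fintype Q] {a b c : ℝ}
    (ha : 0 ≤ a) (hb : 0 ≤ b) (hc : 0 ≤ c) :
    Seminorm ℂ ((Q → ℂ) × (Vec p n → ℂ) × (Vec p n → ℂ)) :=
  Seminorm.of (fun t => a * L1 t.2.1 + b * U3 t.2.2 + c * ∑ i, ‖t.1 i‖)
    (fun s t => by
      have h1 := mul_le_mul_of_nonneg_left (L1_add_le s.2.1 t.2.1) ha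
      have h2 := mul_le_mul_of_nonneg_left (U3_add_le s.2.2 t.2.2) hb
      have h3 : c * ∑ i, ‖s.1 i + t.1 i‖ ≤ c * (∑ i, ‖s.1 i‖ + ∑ i, ‖t.1 i‖) := by
        rw [← Finset.sum_add_distrib]
        gcongr
        exact norm_add_le _ _
      simp only [Prod.fst_add, Prod.snd_add, Pi.add_apply]
      linarith)
    (fun z t => by
      simp only [Prod.smul_fst, Prod.smul_snd, L1_smul, U3_smul, Pi.smul_apply, norm_smul,
        ← Finset.mul_sum]
      ring)

/-- Theorem 2.4. Assuming the `U³` inverse theorem with constant `C`,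
every `f` with `‖f‖₂ ≤ 1` decomposes as a linear combination of quadratic phases plus an
`L¹`-small part plus a `U³`-small part, with `M = exp(C(ηδ)^{-C})`. -/
theorem stmt4 (p : ℕ) [Fact p.Prime] (n : ℕ) (C : ℝ) (hC : 0 < C)
    (hinv : ∀ δ : ℝ, 0 < δ → δ ≤ 1 → ∀ φ : Vec p n → ℂ, Linf φ ≤ 1 → δ ≤ U3 φ →
      ∃ q : Vec p n → ZMod p, IsPolyQuad q ∧
        Real.exp (-(C * δ ^ (-C))) ≤ ‖avgC (fun x => φ x * omg p (q x))‖)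
    (f : Vec p n → ℂ) (hf : L2 f ≤ 1) (δ η : ℝ) (hδ : 0 < δ) (hη : 0 < η) :
    ∃ (k : ℕ) (lam : Fin k → ℂ) (q : Fin k → (Vec p n → ZMod p)) (g h : Vec p n → ℂ),
      (∀ i, IsPolyQuad (q i)) ∧
      (∀ x, f x = (∑ i, lam i * omg p (q i x)) + g x + h x) ∧
      η⁻¹ * L1 g + δ⁻¹ * U3 h +
        (Real.exp (C * (η * δ) ^ (-C)))⁻¹ * (∑ i, ‖lam i‖) ≤ 1 := by
  rcases le_or_gt 1 η with hη1 | hη1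
  · refine ⟨0, Fin.elim0, Fin.elim0, f, 0, fun i => i.elim0, fun x => by simp, ?_⟩
    simp only [U3_zero, Finset.univ_eq_empty, Finset.sum_empty, mul_zero, add_zero]
    rw [inv_mul_le_one₀ hη]
    exact ((L1_le_L2 f).trans hf).trans hη1
  classical
  let Q := {q : Vec p n → ZMod p // IsPolyQuad q}
  have : Fintype Q := Fintype.ofFinite Q
  set M := Real.exp (C * (η * δ) ^ (-C))
  have hM0 : 0 ≤ M⁻¹ := by positivity
  have hη0 : 0 ≤ η⁻¹ := by positivity
  have hδ0 : 0 ≤ δ⁻¹ := by positivity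
  let A₀ : ((Q → ℂ) × (Vec p n → ℂ) × (Vec p n → ℂ)) →ₗ[ℂ] (Vec p n → ℂ) :=
    { toFun := fun t => (fun x => ∑ i : Q, t.1 i * omg p (i.1 x)) + t.2.1 + t.2.2
      map_add' := fun s t => by
        ext x
        simp only [Prod.fst_add, Prod.snd_add, Pi.add_apply, add_mul, Finset.sum_add_distrib]
        ring
      map_smul' := fun z t => by
        ext x
        simp only [Prod.smul_fst, Prod.smul_snd, Pi.add_apply, Pi.smul_apply, smul_eq_mul,
          mul_assoc, ← Finset.mul_sum, mul_add, RingHom.id_apply] }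
  let A := LinearMap.toContinuousLinearMap A₀
  have hA : ∀ t, A t = (fun x => ∑ i : Q, t.1 i * omg p (i.1 x)) + t.2.1 + t.2.2 := fun _ => rfl
  let N := decompSeminorm (p := p) (n := n) Q hη0 hδ0 hM0
  have hN : ∀ t, N t = η⁻¹ * L1 t.2.1 + δ⁻¹ * U3 t.2.2 + M⁻¹ * ∑ i, ‖t.1 i‖ := fun _ => rfl
  have hsurj : Function.Surjective A := fun g => ⟨(0, g, 0), by ext; simp [hA]⟩
  have hcont : Continuous N := by
    have h1 := continuous_L1 (p := p) (n := n)
    have h2 := continuous_U3 (p := p) (n := n)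
    change Continuous fun t : (Q → ℂ) × (Vec p n → ℂ) × (Vec p n → ℂ) =>
      η⁻¹ * L1 t.2.1 + δ⁻¹ * U3 t.2.2 + M⁻¹ * ∑ i, ‖t.1 i‖
    fun_prop
  obtain ⟨t, htf, ht⟩ := exists_preimage_seminorm_le_one A hsurj N hcont f fun L hL => by
    refine norm_dual_lt_one hδ hη hη1 hinv hf L (fun g => ?_) (fun h => ?_) (fun q hq => ?_)
    · have h1 : A (0, g, 0) = g := by ext; simp [hA]
      simpa [h1, hN, U3_zero] using hL (0, g, 0)
    · have h1 : A (0, 0, h) = h := by ext; simp [hA]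
      simpa [h1, hN, L1_zero] using hL (0, 0, h)
    · have h1 : A (Pi.single ⟨q, hq⟩ 1, 0, 0) = fun x => omg p (q x) := by
        ext x
        simp only [hA, add_zero]
        rw [Finset.sum_eq_single ⟨q, hq⟩ (fun y _ hy => by simp [hy]) (by simp)]
        simp
      have h2 : ∑ i : Q, ‖(Pi.single ⟨q, hq⟩ 1 : Q → ℂ) i‖ = 1 := by
        rw [Finset.sum_eq_single ⟨q, hq⟩ (fun y _ hy => by simp [hy]) (by simp)]
        simp
      have h3 := hL (Pi.single ⟨q, hq⟩ 1, 0, 0)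
      rwa [h1, hN, h2, L1_zero, U3_zero, mul_zero, mul_zero, mul_one, zero_add, zero_add] at h3
  let e := Fintype.equivFin Q
  refine ⟨Fintype.card Q, fun i => t.1 (e.symm i), fun i => (e.symm i).1, t.2.1, t.2.2,
    fun i => (e.symm i).2, fun x => ?_, ?_⟩
  · rw [Equiv.sum_comp e.symm fun i : Q => t.1 i * omg p (i.1 x), ← htf]
    rfl
  · rw [Equiv.sum_comp e.symm fun i : Q => ‖t.1 i‖]
    exact ht
end

section
/- Let p be a prime, let V and V' be linear subspaces of 𝔽_p^n, and let q and q' be quadratic forms on V and V' respectively. Suppose that the codimension of V ∩ V' in 𝔽_p^n is d and that the rank of the restriction of q − q' to V ∩ V' is r. Let Q and Q' be quadratic averages with bases (V,q) and (V',q') respectively. Then ‖Q·conj(Q')‖_{U^2}^* ≤ p^{3(d+r)/4}. -/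
open scoped BigOperators

lemma mem_subFinset {p n : ℕ} [NeZero p] {V : Submodule (ZMod p) (Vec p n)} {v : Vec p n} :
    v ∈ subFinset V ↔ v ∈ V := by
  simp [subFinset]

lemma card_subFinset {p n : ℕ} [Fact p.Prime] (V : Submodule (ZMod p) (Vec p n)) :
    (subFinset V).card = p ^ Module.finrank (ZMod p) V := by
  have h : Nat.card V = (subFinset V).card :=
    Nat.subtype_card _ fun _ => mem_subFinset
  rw [← h, Module.natCard_eq_pow_finrank (K := ZMod p), Nat.card_zmod]

lemma sum_subFinset_add_left {p n : ℕ} [NeZero p] {V : Submodule (ZMod p) (Vec p n)}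
    {w : Vec p n} (hw : w ∈ V) (F : Vec p n → ℂ) :
    ∑ v ∈ subFinset V, F (w + v) = ∑ v ∈ subFinset V, F v := by
  refine Finset.sum_nbij' (fun v => w + v) (fun v => v - w) ?_ ?_ ?_ ?_ ?_
  · exact fun v hv => mem_subFinset.2 (V.add_mem hw (mem_subFinset.1 hv))
  · exact fun v hv => mem_subFinset.2 (V.sub_mem (mem_subFinset.1 hv) hw)
  all_goals simp

lemma omg_eq_stdAddChar (p : ℕ) [NeZero p] (t : ZMod p) : omg p t = ZMod.stdAddChar t := by
  rw [omg, ZMod.stdAddChar_apply, ZMod.toCircle_apply]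

lemma omg_add (p : ℕ) [NeZero p] (s t : ZMod p) : omg p (s + t) = omg p s * omg p t := by
  simp only [omg_eq_stdAddChar, AddChar.map_add_eq_mul]

lemma norm_omg (p : ℕ) [NeZero p] (t : ZMod p) : ‖omg p t‖ = 1 := by
  rw [omg_eq_stdAddChar, ZMod.stdAddChar_apply, Circle.norm_coe]

lemma star_mul_omg_self (p : ℕ) [NeZero p] (t : ZMod p) : star (omg p t) * omg p t = 1 := by
  have h := Complex.conj_mul' (omg p t)
  rw [norm_omg] at h
  simpa using h

/-- The `U²` norm in terms of the autocorrelations of `f`. -/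
lemma U2_pow_four {p n : ℕ} [NeZero p] (f : Vec p n → ℂ) :
    U2 f ^ 4 = (∑ a, ‖∑ x, f x * star (f (x + a))‖ ^ 2) / (Fintype.card (Vec p n) : ℝ) ^ 3 := by
  have hsum : ∑ t : Vec p n × Vec p n × Vec p n,
      f t.1 * star (f (t.1 + t.2.1)) * star (f (t.1 + t.2.2)) * f (t.1 + t.2.1 + t.2.2)
      = ((∑ a, ‖∑ x, f x * star (f (x + a))‖ ^ 2 : ℝ) : ℂ) := by
    rw [Fintype.sum_prod_type]
    simp_rw [Fintype.sum_prod_type]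
    rw [Finset.sum_comm]
    push_cast
    refine Finset.sum_congr rfl fun a _ => ?_
    rw [← Complex.mul_conj', map_sum, Finset.sum_mul]
    refine Finset.sum_congr rfl fun x _ => ?_
    rw [← Equiv.sum_comp (Equiv.addLeft x) fun y => (starRingEnd ℂ) (f y * star (f (y + a))),
      Finset.mul_sum]
    refine Finset.sum_congr rfl fun b _ => ?_
    simp only [Equiv.coe_addLeft, map_mul, Complex.star_def, Complex.conj_conj,
      add_right_comm x a b]
    ring
  have hnn : 0 ≤ ∑ a, ‖∑ x, f x * star (f (x + a))‖ ^ 2 :=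
    Finset.sum_nonneg fun _ _ => by positivity
  rw [U2, ← Real.rpow_natCast, ← Real.rpow_mul (norm_nonneg _)]
  norm_num only [Nat.cast_ofNat, Real.rpow_one]
  rw [avgC, hsum, norm_div, Complex.norm_real, Real.norm_of_nonneg hnn,
    Complex.norm_natCast, Fintype.card_prod, Fintype.card_prod]
  push_cast
  ring

/-- Correlation with a character on one coset of a subspace is controlled by the `U²` norm. -/
lemma norm_sum_coset_pow_four_le {p n : ℕ} [NeZero p] (R : Submodule (ZMod p) (Vec p n))
    (f : Vec p n → ℂ) (l : Vec p n → ZMod p)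
    (hl : ∀ u ∈ R, ∀ v ∈ R, l (u + v) = l u + l v) (z : Vec p n) :
    ‖∑ w ∈ subFinset R, f (z + w) * star (omg p (l w))‖ ^ 4
      ≤ (subFinset R).card * (Fintype.card (Vec p n) : ℝ) ^ 3 * U2 f ^ 4 := by
  set S : Vec p n → ℂ := fun x => ∑ w ∈ subFinset R, f (x + w) * star (omg p (l w)) with hS
  set A : Vec p n → ℂ := fun a => ∑ x, f x * star (f (x + a)) with hA
  set k : ℝ := ((subFinset R).card : ℝ) with hk
  have hkpos : 0 < k := by
    rw [hk]
    exact_mod_cast Finset.card_pos.2 ⟨0, mem_subFinset.2 R.zero_mem⟩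
  have hN : (0 : ℝ) < Fintype.card (Vec p n) := by exact_mod_cast Fintype.card_pos
  have hid : ((∑ x, ‖S x‖ ^ 2 : ℝ) : ℂ) = k * ∑ b ∈ subFinset R, omg p (l b) * A b := by
    calc ((∑ x, ‖S x‖ ^ 2 : ℝ) : ℂ)
        = ∑ x, ∑ c ∈ subFinset R, ∑ b ∈ subFinset R,
            omg p (l b) * (f (x + c) * star (f (x + c + b))) := by
          push_cast
          refine Finset.sum_congr rfl fun x _ => ?_
          rw [← Complex.mul_conj', hS, map_sum, Finset.sum_mul]
          refine Finset.sum_congr rfl fun c hc => ?_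
          rw [← sum_subFinset_add_left (mem_subFinset.1 hc), Finset.mul_sum]
          refine Finset.sum_congr rfl fun b hb => ?_
          rw [hl c (mem_subFinset.1 hc) b (mem_subFinset.1 hb), omg_add]
          have h1 := star_mul_omg_self p (l c)
          simp only [Complex.star_def, map_mul, Complex.conj_conj, ← add_assoc] at h1 ⊢
          linear_combination (f (x + c) * (starRingEnd ℂ) (f (x + c + b)) * omg p (l b)) * h1
      _ = ∑ c ∈ subFinset R, ∑ b ∈ subFinset R, omg p (l b) * A b := by
          rw [Finset.sum_comm]
          refine Finset.sum_congr rfl fun c _ => ?_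
          rw [Finset.sum_comm]
          refine Finset.sum_congr rfl fun b _ => ?_
          rw [← Finset.mul_sum]
          congr 1
          exact Equiv.sum_comp (Equiv.addRight c) fun x => f x * star (f (x + b))
      _ = _ := by rw [Finset.sum_const, nsmul_eq_mul, hk, Complex.ofReal_natCast]
  have hconst : ∀ c ∈ subFinset R, ‖S (z + c)‖ = ‖S z‖ := by
    intro c hc
    have : S z = star (omg p (l c)) * S (z + c) := by
      simp only [hS]
      rw [← sum_subFinset_add_left (mem_subFinset.1 hc), Finset.mul_sum]
      refine Finset.sum_congr rfl fun b hb => ?_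
      rw [hl c (mem_subFinset.1 hc) b (mem_subFinset.1 hb), omg_add, star_mul', add_assoc]
      ring
    rw [this, norm_mul, norm_star, norm_omg, one_mul]
  have hlow : k * ‖S z‖ ^ 2 ≤ ∑ x, ‖S x‖ ^ 2 := by
    calc k * ‖S z‖ ^ 2 = ∑ c ∈ subFinset R, ‖S (z + c)‖ ^ 2 := by
          rw [Finset.sum_congr rfl fun c hc => by rw [hconst c hc], Finset.sum_const, nsmul_eq_mul]
      _ ≤ ∑ c, ‖S (z + c)‖ ^ 2 :=
          Finset.sum_le_sum_of_subset_of_nonneg (Finset.subset_univ _) fun _ _ _ => by positivity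
      _ = _ := Equiv.sum_comp (Equiv.addLeft z) fun x => ‖S x‖ ^ 2
  have hup : ∑ x, ‖S x‖ ^ 2 ≤ k * ∑ b ∈ subFinset R, ‖A b‖ := by
    have h := congrArg norm hid
    rw [Complex.norm_real, Real.norm_of_nonneg (Finset.sum_nonneg fun _ _ => by positivity),
      norm_mul, Complex.norm_real, Real.norm_of_nonneg hkpos.le] at h
    rw [h]
    gcongr
    refine (norm_sum_le _ _).trans_eq (Finset.sum_congr rfl fun b _ => ?_)
    rw [norm_mul, norm_omg, one_mul]
  have hS2 : ‖S z‖ ^ 2 ≤ ∑ b ∈ subFinset R, ‖A b‖ := le_of_mul_le_mul_left (hlow.trans hup) hkpos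
  calc ‖S z‖ ^ 4 = (‖S z‖ ^ 2) ^ 2 := by ring
    _ ≤ (∑ b ∈ subFinset R, ‖A b‖) ^ 2 := by gcongr
    _ ≤ k * ∑ b ∈ subFinset R, ‖A b‖ ^ 2 := sq_sum_le_card_mul_sum_sq
    _ ≤ k * ∑ b, ‖A b‖ ^ 2 := by
        gcongr
        exact Finset.subset_univ _
    _ = _ := by
        rw [U2_pow_four, hA]
        field_simp

lemma IsQuadFormOn.mono {p n : ℕ} {V W : Submodule (ZMod p) (Vec p n)} {q : Vec p n → ZMod p}
    (hq : IsQuadFormOn V q) (h : W ≤ V) : IsQuadFormOn W q :=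
  ⟨hq.1, fun u hu v hv w hw => hq.2 u (h hu) v (h hv) w (h hw)⟩

lemma IsQuadFormOn.sub {p n : ℕ} {V : Submodule (ZMod p) (Vec p n)} {q q' : Vec p n → ZMod p}
    (hq : IsQuadFormOn V q) (hq' : IsQuadFormOn V q') :
    IsQuadFormOn V (fun x => q x - q' x) := by
  refine ⟨by simp [hq.1, hq'.1], fun u hu v hv w hw => ?_⟩
  have h := hq.2 u hu v hv w hw
  have h' := hq'.2 u hu v hv w hw
  simp only [qbeta] at h h' ⊢
  linear_combination h - h'

lemma qRadical_le {p n : ℕ} (V : Submodule (ZMod p) (Vec p n)) (q : Vec p n → ZMod p) :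
    qRadical V q ≤ V :=
  Submodule.span_le.2 fun _ hv => hv.1

lemma qbeta_eq_zero_of_mem_qRadical {p n : ℕ} {V : Submodule (ZMod p) (Vec p n)}
    {q : Vec p n → ZMod p} (hq : IsQuadFormOn V q) {u v : Vec p n} (hu : u ∈ V)
    (hv : v ∈ qRadical V q) : qbeta q u v = 0 := by
  have h0 : qbeta q u 0 = 0 := by simp [qbeta, hq.1]
  let K : AddSubgroup (Vec p n) :=
    { carrier := {v | v ∈ V ∧ qbeta q u v = 0}
      zero_mem' := ⟨V.zero_mem, h0⟩
      add_mem' := fun {a b} ha hb =>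
        ⟨V.add_mem ha.1 hb.1, by rw [hq.2 u hu a ha.1 b hb.1, ha.2, hb.2, add_zero]⟩
      neg_mem' := fun {a} ha => ⟨V.neg_mem ha.1, by
        have h := hq.2 u hu a ha.1 (-a) (V.neg_mem ha.1)
        rwa [add_neg_cancel, h0, ha.2, zero_add, eq_comm] at h⟩ }
  have hle : qRadical V q ≤ AddSubgroup.toZModSubmodule p K :=
    Submodule.span_le.2 fun w hw => ⟨hw.1, hw.2 u hu⟩
  exact (hle hv).2

lemma quadForm_add_of_mem_qRadical {p n : ℕ} {V : Submodule (ZMod p) (Vec p n)}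
    {q : Vec p n → ZMod p} (hq : IsQuadFormOn V q) {u v : Vec p n} (hu : u ∈ V)
    (hv : v ∈ qRadical V q) : q (u + v) = q u + q v := by
  have h := qbeta_eq_zero_of_mem_qRadical hq hu hv
  rw [qbeta] at h
  linear_combination h

/-- On a coset of `V`, a quadratic average with base `(V, q)` is an average of quadratic phases
with quadratic part `q`. -/
lemma IsQuadAvgWith.exists_eq_sum {p n : ℕ} [NeZero p] {V : Submodule (ZMod p) (Vec p n)}
    {q : Vec p n → ZMod p} {Q : Vec p n → ℂ} (hQ : IsQuadAvgWith V q Q) (z : Vec p n) :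
    ∃ (c : Vec p n → ZMod p) (l : Vec p n → Vec p n → ZMod p),
      (∀ u ∈ V, ∀ v ∈ V, ∀ w ∈ V, l u (v + w) = l u v + l u w) ∧
      ∀ w ∈ V, Q (z + w) =
        (∑ u ∈ subFinset V, omg p (c u + (q w + l u w))) / ((subFinset V).card : ℂ) := by
  obtain ⟨hq, φ, hφ, hQ⟩ := hQ
  refine ⟨fun u => q u + φ (z - u) u, fun u w => qbeta q u w + φ (z - u) w, ?_, ?_⟩
  · intro u hu v hv w hw
    simp only [hq.2 u hu v hv w hw, hφ _ v hv w hw]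
    ring
  · intro w hw
    rw [hQ, ← sum_subFinset_add_left hw]
    congr 1
    refine Finset.sum_congr rfl fun u hu => ?_
    congr 1
    rw [hφ _ w hw u (mem_subFinset.1 hu), add_comm z w, add_sub_add_left_eq_sub]
    simp only [qbeta, add_comm u w]
    ring

lemma norm_sum_coset_quadAvg_le {p n : ℕ} [NeZero p] {V V' : Submodule (ZMod p) (Vec p n)}
    {q q' : Vec p n → ZMod p} {Q Q' : Vec p n → ℂ}
    (hQ : IsQuadAvgWith V q Q) (hQ' : IsQuadAvgWith V' q' Q')
    {R : Submodule (ZMod p) (Vec p n)} (hR : R ≤ V) (hR' : R ≤ V')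
    (hlin : ∀ u ∈ R, ∀ v ∈ R, q (u + v) - q' (u + v) = (q u - q' u) + (q v - q' v))
    (f : Vec p n → ℂ) {B : ℝ} (z : Vec p n)
    (hB : ∀ l : Vec p n → ZMod p, (∀ u ∈ R, ∀ v ∈ R, l (u + v) = l u + l v) →
      ‖∑ w ∈ subFinset R, f (z + w) * star (omg p (l w))‖ ≤ B) :
    ‖∑ w ∈ subFinset R, f (z + w) * star (Q (z + w) * star (Q' (z + w)))‖ ≤ B := by
  obtain ⟨c, l, hl, hc⟩ := hQ.exists_eq_sum z
  obtain ⟨c', l', hl', hc'⟩ := hQ'.exists_eq_sum z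
  have hpos : ∀ U : Submodule (ZMod p) (Vec p n), (0 : ℝ) < (subFinset U).card := fun U => by
    exact_mod_cast Finset.card_pos.2 ⟨0, mem_subFinset.2 U.zero_mem⟩
  have hV := hpos V
  have hV' := hpos V'
  set L : Vec p n → Vec p n → Vec p n → ZMod p :=
    fun u u' w => (q w - q' w) + (l u w - l' u' w) with hL
  have hstar : ∀ s t : ZMod p, omg p s * star (omg p t) = omg p (s - t) := fun s t => by
    have h := star_mul_omg_self p t
    rw [← sub_add_cancel s t, omg_add, add_sub_cancel_right]
    linear_combination omg p (s - t) * h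
  have hsum : ∑ w ∈ subFinset R, f (z + w) * star (Q (z + w) * star (Q' (z + w))) =
      (∑ u ∈ subFinset V, ∑ u' ∈ subFinset V', star (omg p (c u - c' u')) *
        ∑ w ∈ subFinset R, f (z + w) * star (omg p (L u u' w))) /
        (((subFinset V).card : ℂ) * ((subFinset V').card : ℂ)) := by
    simp_rw [Finset.mul_sum]
    rw [Finset.sum_congr rfl fun u _ => Finset.sum_comm, Finset.sum_comm, Finset.sum_div]
    refine Finset.sum_congr rfl fun w hw => ?_
    have hw' := mem_subFinset.1 hw
    have hprod : Q (z + w) * star (Q' (z + w)) = (∑ u ∈ subFinset V, ∑ u' ∈ subFinset V',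
        omg p (c u - c' u' + L u u' w)) /
        (((subFinset V).card : ℂ) * ((subFinset V').card : ℂ)) := by
      rw [hc w (hR hw'), hc' w (hR' hw'), star_div₀, star_sum, star_natCast, div_mul_div_comm,
        Finset.sum_mul_sum]
      congr 1
      refine Finset.sum_congr rfl fun u _ => Finset.sum_congr rfl fun u' _ => ?_
      rw [hstar]
      congr 1
      simp only [hL]
      ring
    rw [hprod, star_div₀, star_mul', star_natCast, star_natCast, ← mul_div_assoc]
    simp_rw [star_sum, Finset.mul_sum]
    congr 1
    refine Finset.sum_congr rfl fun u _ => Finset.sum_congr rfl fun u' _ => ?_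
    rw [omg_add, star_mul']
    ring
  rw [hsum, norm_div, norm_mul, Complex.norm_natCast, Complex.norm_natCast,
    div_le_iff₀ (by positivity)]
  have hterm : ∀ u ∈ subFinset V, ∀ u' ∈ subFinset V', ‖star (omg p (c u - c' u')) *
      ∑ w ∈ subFinset R, f (z + w) * star (omg p (L u u' w))‖ ≤ B := by
    intro u hu u' hu'
    rw [norm_mul, norm_star, norm_omg, one_mul]
    refine hB _ fun v hv w hw => ?_
    simp only [hL]
    rw [hl u (mem_subFinset.1 hu) v (hR hv) w (hR hw),
      hl' u' (mem_subFinset.1 hu') v (hR' hv) w (hR' hw)]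
    linear_combination hlin v hv w hw
  calc _ ≤ ∑ u ∈ subFinset V, ∑ u' ∈ subFinset V', B :=
        norm_sum_le_of_le _ fun u hu => norm_sum_le_of_le _ fun u' hu' => hterm u hu u' hu'
    _ = _ := by
        simp only [Finset.sum_const, nsmul_eq_mul]
        ring

lemma norm_inprod_le_of_coset {p n : ℕ} [NeZero p] (R : Submodule (ZMod p) (Vec p n))
    (f g : Vec p n → ℂ) {B : ℝ}
    (hB : ∀ z, ‖∑ w ∈ subFinset R, f (z + w) * star (g (z + w))‖ ≤ B) :
    ‖inprod f g‖ ≤ B / (subFinset R).card := by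
  have hk : (0 : ℝ) < (subFinset R).card := by
    exact_mod_cast Finset.card_pos.2 ⟨0, mem_subFinset.2 R.zero_mem⟩
  have hN : (0 : ℝ) < Fintype.card (Vec p n) := by exact_mod_cast Fintype.card_pos
  have hsum : ((subFinset R).card : ℂ) * ∑ x, f x * star (g x) =
      ∑ z, ∑ w ∈ subFinset R, f (z + w) * star (g (z + w)) := by
    rw [Finset.sum_comm, ← nsmul_eq_mul, ← Finset.sum_const]
    exact Finset.sum_congr rfl fun w _ =>
      (Equiv.sum_comp (Equiv.addRight w) fun x => f x * star (g x)).symm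
  have hle : (subFinset R).card * ‖∑ x, f x * star (g x)‖ ≤ Fintype.card (Vec p n) * B := by
    rw [← Complex.norm_natCast, ← norm_mul, hsum]
    refine (norm_sum_le_of_le _ fun z _ => hB z).trans_eq ?_
    rw [Finset.sum_const, nsmul_eq_mul, Finset.card_univ]
  rw [inprod, avgC, norm_div, Complex.norm_natCast, div_le_div_iff₀ hN hk]
  linarith

/-- Lemma 4.6. If `Q, Q'` are quadratic averages with bases `(V,q)`,
`(V',q')`, where `V ⊓ V'` has codimension `d` and `q - q'` has rank `r` on `V ⊓ V'`,
then `‖Q·conj(Q')‖_{U²}^* ≤ p^{3(d+r)/4}`. -/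
theorem stmt9 (p : ℕ) [Fact p.Prime] (n : ℕ)
    (V V' : Submodule (ZMod p) (Vec p n))
    (q q' : Vec p n → ZMod p) (Q Q' : Vec p n → ℂ) (d r : ℕ)
    (hd : n - Module.finrank (ZMod p) (V ⊓ V' : Submodule (ZMod p) (Vec p n)) = d)
    (hr : qRank (V ⊓ V') (fun x => q x - q' x) = r)
    (hQ : IsQuadAvgWith V q Q) (hQ' : IsQuadAvgWith V' q' Q') :
    U2dual (fun x => Q x * star (Q' x)) ≤ (p : ℝ) ^ ((3 * ((d : ℝ) + r)) / 4) := by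
  set R := qRadical (V ⊓ V') (fun x => q x - q' x) with hR
  have hq := (hQ.1.mono inf_le_left).sub (hQ'.1.mono (inf_le_right : V ⊓ V' ≤ V'))
  have hRW : R ≤ V ⊓ V' := qRadical_le _ _
  have hp : (0 : ℝ) < p := by exact_mod_cast (Fact.out : p.Prime).pos
  have hdim : Module.finrank (ZMod p) R + (d + r) = n := by
    have h1 := Submodule.finrank_mono hRW
    have h2 := Submodule.finrank_le (V ⊓ V')
    rw [Module.finrank_fin_fun] at h2
    rw [qRank, ← hR] at hr
    omega
  refine Real.sSup_le ?_ (by positivity)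
  rintro _ ⟨f, hf, rfl⟩
  set k : ℕ := Module.finrank (ZMod p) R
  have hcard : ((subFinset R).card : ℝ) = (p : ℝ) ^ k := by
    rw [card_subFinset]
    push_cast
    rfl
  have hN : (Fintype.card (Vec p n) : ℝ) = (p : ℝ) ^ n := by
    simp [ZMod.card]
  have hexp : (p : ℝ) ^ k * ((p : ℝ) ^ n) ^ 3 =
      ((p : ℝ) ^ k * (p : ℝ) ^ ((3 * ((d : ℝ) + r)) / 4)) ^ 4 := by
    rw [mul_pow, ← Real.rpow_natCast ((p : ℝ) ^ ((3 * ((d : ℝ) + r)) / 4)), ← Real.rpow_mul hp.le,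
      show (3 * ((d : ℝ) + r)) / 4 * ((4 : ℕ) : ℝ) = ((3 * (d + r) : ℕ) : ℝ) by push_cast; ring,
      Real.rpow_natCast, ← pow_mul, ← pow_mul, ← pow_add, ← pow_add, ← hdim]
    congr 1
    ring
  have hf4 : U2 f ^ 4 ≤ 1 := pow_le_one₀ (Real.rpow_nonneg (norm_nonneg _) _) hf
  have hbound := norm_inprod_le_of_coset R f (fun x => Q x * star (Q' x)) fun z =>
    norm_sum_coset_quadAvg_le (B := (p : ℝ) ^ k * (p : ℝ) ^ ((3 * ((d : ℝ) + r)) / 4)) hQ hQ'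
      (hRW.trans inf_le_left) (hRW.trans inf_le_right)
      (fun u hu v hv => quadForm_add_of_mem_qRadical hq (hRW hu) hv) f z fun l hl => by
        refine le_of_pow_le_pow_left₀ four_ne_zero (by positivity) ?_
        rw [← hexp]
        refine (norm_sum_coset_pow_four_le R f l hl z).trans ?_
        rw [hcard, hN]
        exact mul_le_of_le_one_right (by positivity) hf4
  rwa [hcard, mul_div_cancel_left₀ _ (by positivity)] at hbound
end
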